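/- Let w = (w_1,…,w_n) be positive integer weights, let l ≥ 1 be an integer, and let f be a smooth vector field on ℝⁿ of graded order at most l, i.e. ∂^α f^{(j)}(0) = 0 for every component index j and every multi-index α with w_j − Σ_s α_s w_s > l. Let f̂ be the weighted Taylor part of f of weight l. Then: (a) f̂ is δ-homogeneous of weight l, i.e. δ_ε(f̂(x)) = ε^l f̂(δ_ε x) for all ε > 0 and x ∈ ℝⁿ; and (b) for every x ∈ ℝⁿ, ε^l · δ_{1/ε}( f(δ_ε x) ) → f̂(x) as ε → 0⁺ (equivalently, ε^l (δ_{1/ε *} f)(x) → f̂(x)). -/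

import Mathlib

open MeasureTheory Filter Topology Set

noncomputable section

/-- Vector fields on `ℝⁿ`. -/
abbrev VF (n : ℕ) := (Fin n → ℝ) → (Fin n → ℝ)

/-- Anisotropic dilation `δ_ε` with positive integer weights `w`. -/
def dil {n : ℕ} (w : Fin n → ℕ) (ε : ℝ) (x : Fin n → ℝ) : Fin n → ℝ :=
  fun j => ε ^ (w j) * x j

/-- Directional derivative along the `s`-th coordinate direction. -/
def dirDeriv {n : ℕ} (s : Fin n) (g : (Fin n → ℝ) → ℝ) : (Fin n → ℝ) → ℝ :=
  fun x => fderiv ℝ g x (Pi.single s 1)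

/-- Iterated directional derivatives along a list of coordinate directions. -/
def listDeriv {n : ℕ} : List (Fin n) → ((Fin n → ℝ) → ℝ) → ((Fin n → ℝ) → ℝ)
  | [], g => g
  | s :: rest, g => dirDeriv s (listDeriv rest g)

/-- The list of coordinate directions encoded by a multi-index `α`. -/
def mIndexList {n : ℕ} (α : Fin n → ℕ) : List (Fin n) :=
  (List.finRange n).flatMap fun s => List.replicate (α s) s

/-- Multi-index partial derivative `∂^α g (0)` at the origin. -/
def mderiv {n : ℕ} (g : (Fin n → ℝ) → ℝ) (α : Fin n → ℕ) : ℝ :=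
  listDeriv (mIndexList α) g 0

/-- `f` has graded order at most `l` (w.r.t. the weights `w`):
`∂^α f^{(j)}(0) = 0` whenever `w_j − Σ_s α_s w_s > l`. -/
def GradedOrderLE {n : ℕ} (w : Fin n → ℕ) (f : VF n) (l : ℤ) : Prop :=
  ∀ (j : Fin n) (α : Fin n → ℕ),
    l < (w j : ℤ) - ∑ s, (α s : ℤ) * (w s : ℤ) →
    mderiv (fun x => f x j) α = 0

/-- The weighted Taylor part of weight `l` of a vector field `f`: its `j`-th
component is `Σ_{α : Σ_s α_s w_s = w_j − l} (∂^α f^{(j)}(0)/α!) x^α`. -/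
def taylorPart {n : ℕ} (w : Fin n → ℕ) (f : VF n) (l : ℕ) : VF n :=
  fun x j =>
    ∑ β : Fin n → Fin (w j + 1),
      if (∑ s, (β s : ℤ) * (w s : ℤ)) = (w j : ℤ) - (l : ℤ) then
        (mderiv (fun y => f y j) (fun s => (β s : ℕ)) /
            ((∏ s, Nat.factorial (β s) : ℕ) : ℝ)) *
          ∏ s, x s ^ (β s : ℕ)
      else 0

/-- The finite set of multi-indices of weighted degree `m`. -/
def weightedIndices {n : ℕ} (w : Fin n → ℕ) (m : ℕ) : Finset (Fin n → ℕ) :=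
  (Fintype.piFinset fun _ => Finset.range (m + 1)).filter fun α => ∑ s, α s * w s = m

/-- The Taylor monomial `∂^α g(0)/α! x^α`. -/
def taylorTerm {n : ℕ} (g : (Fin n → ℝ) → ℝ) (α : Fin n → ℕ) (x : Fin n → ℝ) : ℝ :=
  mderiv g α / ((∏ s, Nat.factorial (α s) : ℕ) : ℝ) * ∏ s, x s ^ α s

/-- The part of weighted degree `m` of the Taylor series of `g` at the origin. -/
def weightedTaylor {n : ℕ} (w : Fin n → ℕ) (m : ℕ) (g : (Fin n → ℝ) → ℝ) (x : Fin n → ℝ) : ℝ :=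
  ∑ α ∈ weightedIndices w m, taylorTerm g α x

lemma le_of_weight_eq {n : ℕ} {w : Fin n → ℕ} (hw : ∀ j, 0 < w j) {m : ℕ} {α : Fin n → ℕ}
    (hα : ∑ s, α s * w s = m) (s : Fin n) : α s ≤ m :=
  calc α s ≤ α s * w s := Nat.le_mul_of_pos_right _ (hw s)
    _ ≤ ∑ t, α t * w t :=
      Finset.single_le_sum (f := fun t => α t * w t) (fun _ _ => Nat.zero_le _) (Finset.mem_univ s)
    _ = m := hα

lemma mem_weightedIndices {n : ℕ} {w : Fin n → ℕ} (hw : ∀ j, 0 < w j) {m : ℕ}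
    {α : Fin n → ℕ} : α ∈ weightedIndices w m ↔ ∑ s, α s * w s = m := by
  simp only [weightedIndices, Finset.mem_filter, Fintype.mem_piFinset, Finset.mem_range,
    and_iff_right_iff_imp]
  exact fun h s => Nat.lt_succ_of_le (le_of_weight_eq hw h s)

lemma weight_add_single {n : ℕ} (w : Fin n → ℕ) (β : Fin n → ℕ) (s : Fin n) :
    ∑ t, (β + Pi.single s 1 : Fin n → ℕ) t * w t = ∑ t, β t * w t + w s := by
  simp [add_mul, Finset.sum_add_distrib, Pi.single_apply]

lemma contDiff_dirDeriv {n : ℕ} {g : (Fin n → ℝ) → ℝ} (hg : ContDiff ℝ (⊤ : ℕ∞) g)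
    (s : Fin n) : ContDiff ℝ (⊤ : ℕ∞) (dirDeriv s g) :=
  (hg.fderiv_right (m := (⊤ : ℕ∞)) (by simp)).clm_apply contDiff_const

lemma contDiff_listDeriv {n : ℕ} {g : (Fin n → ℝ) → ℝ} (hg : ContDiff ℝ (⊤ : ℕ∞) g) :
    ∀ L : List (Fin n), ContDiff ℝ (⊤ : ℕ∞) (listDeriv L g)
  | [] => hg
  | s :: L => contDiff_dirDeriv (contDiff_listDeriv hg L) s

lemma dirDeriv_comm {n : ℕ} {g : (Fin n → ℝ) → ℝ} (hg : ContDiff ℝ (⊤ : ℕ∞) g)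
    (s t : Fin n) : dirDeriv s (dirDeriv t g) = dirDeriv t (dirDeriv s g) := by
  have hd : Differentiable ℝ (fderiv ℝ g) :=
    (hg.fderiv_right (m := (⊤ : ℕ∞)) (by simp)).differentiable (by simp)
  have key (u v : Fin n) (x : Fin n → ℝ) : dirDeriv u (dirDeriv v g) x =
      fderiv ℝ (fderiv ℝ g) x (Pi.single u 1) (Pi.single v 1) := by
    unfold dirDeriv
    rw [fderiv_clm_apply (hd x) (differentiableAt_const _)]
    simp
  funext x
  rw [key, key]
  refine (hg.contDiffAt.isSymmSndFDerivAt ?_).eq _ _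
  rw [minSmoothness_of_isRCLikeNormedField]
  exact WithTop.coe_le_coe.2 le_top

lemma listDeriv_perm {n : ℕ} {g : (Fin n → ℝ) → ℝ} (hg : ContDiff ℝ (⊤ : ℕ∞) g)
    {L₁ L₂ : List (Fin n)} (h : L₁.Perm L₂) : listDeriv L₁ g = listDeriv L₂ g := by
  induction h with
  | nil => rfl
  | cons s _ ih => simp only [listDeriv, ih]
  | swap s t L => exact dirDeriv_comm (contDiff_listDeriv hg L) t s
  | trans _ _ ih₁ ih₂ => exact ih₁.trans ih₂

lemma listDeriv_append_singleton {n : ℕ} (g : (Fin n → ℝ) → ℝ) (s : Fin n) (L : List (Fin n)) :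
    listDeriv (L ++ [s]) g = listDeriv L (dirDeriv s g) := by
  induction L with
  | nil => rfl
  | cons t L ih => simp only [List.cons_append, listDeriv, ih]

lemma count_mIndexList {n : ℕ} (α : Fin n → ℕ) (s : Fin n) :
    (mIndexList α).count s = α s := by
  rw [mIndexList, List.count_flatMap, ← Fin.sum_univ_def]
  simp [List.count_replicate]

lemma mderiv_dirDeriv {n : ℕ} {g : (Fin n → ℝ) → ℝ} (hg : ContDiff ℝ (⊤ : ℕ∞) g)
    (β : Fin n → ℕ) (s : Fin n) : mderiv (dirDeriv s g) β = mderiv g (β + Pi.single s 1) := by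
  unfold mderiv
  rw [← listDeriv_append_singleton]
  refine congrFun (listDeriv_perm hg (List.perm_iff_count.2 fun t => ?_)) 0
  rw [List.count_append, count_mIndexList, count_mIndexList]
  by_cases hts : t = s
  · subst hts
    simp
  · simp [hts, Ne.symm hts]

lemma mIndexList_zero {n : ℕ} : mIndexList (0 : Fin n → ℕ) = [] := by
  simp [mIndexList]

lemma taylorTerm_dirDeriv {n : ℕ} {g : (Fin n → ℝ) → ℝ} (hg : ContDiff ℝ (⊤ : ℕ∞) g)
    (β : Fin n → ℕ) (s : Fin n) (x : Fin n → ℝ) :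
    x s * taylorTerm (dirDeriv s g) β x =
      ((β + Pi.single s 1 : Fin n → ℕ) s : ℕ) * taylorTerm g (β + Pi.single s 1) x := by
  have hfac : ∏ t, Nat.factorial ((β + Pi.single s 1 : Fin n → ℕ) t) =
      (∏ t, Nat.factorial (β t)) * (β s + 1) := by
    have h (t : Fin n) : Nat.factorial ((β + Pi.single s 1 : Fin n → ℕ) t) =
        Nat.factorial (β t) * if t = s then β s + 1 else 1 := by
      by_cases hts : t = s
      · subst hts
        simp [Nat.factorial_succ, mul_comm]
      · simp [hts]
    simp only [h, Finset.prod_mul_distrib, Finset.prod_ite_eq', Finset.mem_univ, if_true]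
  have hpow : ∏ t, x t ^ ((β + Pi.single s 1 : Fin n → ℕ) t) = (∏ t, x t ^ β t) * x s := by
    have h (t : Fin n) : x t ^ ((β + Pi.single s 1 : Fin n → ℕ) t) =
        x t ^ β t * if t = s then x s else 1 := by
      by_cases hts : t = s
      · subst hts
        simp [pow_succ]
      · simp [hts]
    simp only [h, Finset.prod_mul_distrib, Finset.prod_ite_eq', Finset.mem_univ, if_true]
  have h₁ : ((∏ t, Nat.factorial (β t) : ℕ) : ℝ) ≠ 0 :=
    Nat.cast_ne_zero.2 (Finset.prod_ne_zero_iff.2 fun t _ => Nat.factorial_ne_zero _)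
  have h₂ : (β s : ℝ) + 1 ≠ 0 := by positivity
  rw [taylorTerm, taylorTerm, mderiv_dirDeriv hg, hfac, hpow, Nat.cast_mul]
  simp only [Pi.add_apply, Pi.single_eq_same, Nat.cast_add, Nat.cast_one]
  field_simp

lemma sum_coord_mul_taylorTerm {n : ℕ} {w : Fin n → ℕ} (hw : ∀ j, 0 < w j)
    {g : (Fin n → ℝ) → ℝ} (hg : ContDiff ℝ (⊤ : ℕ∞) g) (m : ℕ) (s : Fin n) (x : Fin n → ℝ) :
    ∑ α ∈ weightedIndices w m, (α s : ℝ) * taylorTerm g α x =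
      x s * if w s ≤ m then weightedTaylor w (m - w s) (dirDeriv s g) x else 0 := by
  split_ifs with hs
  · rw [weightedTaylor, Finset.mul_sum]
    symm
    refine Finset.sum_of_injOn (fun β => β + Pi.single s 1) ((add_left_injective _).injOn)
      ?_ ?_ fun β _ => taylorTerm_dirDeriv hg β s x
    · intro β hβ
      simp only [Finset.mem_coe, mem_weightedIndices hw] at hβ ⊢
      rw [weight_add_single, hβ]
      omega
    · intro α hα hne
      rw [mem_weightedIndices hw] at hα
      suffices α s = 0 by simp [this]
      by_contra h0
      have hsub : α - Pi.single s 1 + Pi.single s 1 = α := by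
        funext t
        by_cases hts : t = s
        · subst hts
          simp
          omega
        · simp [hts]
      refine hne ⟨α - Pi.single s 1, ?_, hsub⟩
      have := weight_add_single w (α - Pi.single s 1) s
      rw [hsub, hα] at this
      simp only [Finset.mem_coe, mem_weightedIndices hw]
      omega
  · rw [mul_zero]
    refine Finset.sum_eq_zero fun α hα => ?_
    rw [mem_weightedIndices hw] at hα
    suffices α s = 0 by simp [this]
    by_contra h0
    have h₁ : α s * w s ≤ m := hα ▸ Finset.single_le_sum (f := fun t => α t * w t)
      (fun _ _ => Nat.zero_le _) (Finset.mem_univ s)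
    have h₂ := Nat.le_mul_of_pos_left (w s) (Nat.pos_of_ne_zero h0)
    omega

/-- Euler's identity for the weighted homogeneous parts of the Taylor series. -/
lemma euler_weightedTaylor {n : ℕ} {w : Fin n → ℕ} (hw : ∀ j, 0 < w j)
    {g : (Fin n → ℝ) → ℝ} (hg : ContDiff ℝ (⊤ : ℕ∞) g) (m : ℕ) (x : Fin n → ℝ) :
    ∑ s, w s * x s * (if w s ≤ m then weightedTaylor w (m - w s) (dirDeriv s g) x else 0) =
      m * weightedTaylor w m g x := by
  simp_rw [mul_assoc, ← sum_coord_mul_taylorTerm hw hg, Finset.mul_sum]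
  rw [Finset.sum_comm, weightedTaylor, Finset.mul_sum]
  refine Finset.sum_congr rfl fun α hα => ?_
  rw [mem_weightedIndices hw] at hα
  rw [← hα, Nat.cast_sum, Finset.sum_mul]
  refine Finset.sum_congr rfl fun s _ => ?_
  push_cast
  ring

lemma weightedTaylor_zero {n : ℕ} {w : Fin n → ℕ} (hw : ∀ j, 0 < w j)
    (g : (Fin n → ℝ) → ℝ) (x : Fin n → ℝ) : weightedTaylor w 0 g x = g 0 := by
  have h : weightedIndices w 0 = {0} := by
    ext α
    rw [mem_weightedIndices hw, Finset.mem_singleton]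
    constructor
    · exact fun h => funext fun s => Nat.le_zero.1 (le_of_weight_eq hw h s)
    · rintro rfl
      simp
  simp [weightedTaylor, h, taylorTerm, mderiv, mIndexList_zero, listDeriv]

lemma continuous_dil {n : ℕ} (w : Fin n → ℕ) (x : Fin n → ℝ) :
    Continuous fun ε : ℝ => dil w ε x := by
  unfold dil
  fun_prop

lemma dil_zero {n : ℕ} {w : Fin n → ℕ} (hw : ∀ j, 0 < w j) (x : Fin n → ℝ) :
    dil w 0 x = 0 := by
  funext j
  simp [dil, (hw j).ne']

lemma tendsto_comp_dil {n : ℕ} {w : Fin n → ℕ} (hw : ∀ j, 0 < w j)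
    {g : (Fin n → ℝ) → ℝ} (hg : Continuous g) (x : Fin n → ℝ) :
    Tendsto (fun ε : ℝ => g (dil w ε x)) (𝓝[>] 0) (𝓝 (g 0)) := by
  have h := ((hg.comp (continuous_dil w x)).tendsto 0).mono_left
    (nhdsWithin_le_nhds (s := Ioi 0))
  simpa only [Function.comp_def, dil_zero hw] using h

lemma hasDerivAt_comp_dil {n : ℕ} (w : Fin n → ℕ) {g : (Fin n → ℝ) → ℝ}
    (hg : ContDiff ℝ (⊤ : ℕ∞) g) (x : Fin n → ℝ) (ε : ℝ) :
    HasDerivAt (fun ε : ℝ => g (dil w ε x))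
      (∑ s, w s * x s * (ε ^ (w s - 1) * dirDeriv s g (dil w ε x))) ε := by
  have hd : HasDerivAt (fun ε : ℝ => dil w ε x)
      (fun s => (w s : ℝ) * ε ^ (w s - 1) * x s) ε :=
    hasDerivAt_pi.2 fun s => (hasDerivAt_pow (w s) ε).mul_const (x s)
  have h := (hg.differentiable (by simp) (dil w ε x)).hasFDerivAt.comp_hasDerivAt ε hd
  refine h.congr_deriv ?_
  conv_lhs => rw [pi_eq_sum_univ' (fun s => (w s : ℝ) * ε ^ (w s - 1) * x s)]
  rw [map_sum]
  refine Finset.sum_congr rfl fun s _ => ?_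
  rw [map_smul, smul_eq_mul, dirDeriv]
  ring

/-- A weighted Taylor theorem: if all derivatives of `g` of weighted degree less than `m` vanish at
the origin, then `g ∘ δ_ε` is asymptotic to `ε ^ m` times its part of weighted degree `m`. -/
lemma tendsto_comp_dil_div_pow {n : ℕ} {w : Fin n → ℕ} (hw : ∀ j, 0 < w j) (x : Fin n → ℝ)
    (m : ℕ) : ∀ {g : (Fin n → ℝ) → ℝ}, ContDiff ℝ (⊤ : ℕ∞) g →
      (∀ α : Fin n → ℕ, ∑ s, α s * w s < m → mderiv g α = 0) →
      Tendsto (fun ε : ℝ => g (dil w ε x) / ε ^ m) (𝓝[>] 0) (𝓝 (weightedTaylor w m g x)) := by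
  induction m using Nat.strong_induction_on with
  | _ m ih =>
  intro g hg hvan
  rcases Nat.eq_zero_or_pos m with rfl | hm
  · simpa [weightedTaylor_zero hw] using tendsto_comp_dil hw hg.continuous x
  have hm0 : (m : ℝ) ≠ 0 := Nat.cast_ne_zero.2 hm.ne'
  have hpos : ∀ᶠ ε : ℝ in 𝓝[>] 0, 0 < ε := self_mem_nhdsWithin
  have hid : Tendsto (fun ε : ℝ => ε) (𝓝[>] 0) (𝓝 0) := nhdsWithin_le_nhds
  have hpow {k : ℕ} (hk : k ≠ 0) : Tendsto (fun ε : ℝ => ε ^ k) (𝓝[>] 0) (𝓝 0) := by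
    simpa [hk] using hid.pow k
  refine HasDerivAt.lhopital_zero_nhdsGT
    (Eventually.of_forall fun ε => hasDerivAt_comp_dil w hg x ε)
    (Eventually.of_forall fun ε => hasDerivAt_pow m ε) ?_ ?_ (hpow hm.ne') ?_
  · filter_upwards [hpos] with ε hε
    positivity
  · have h0 : g 0 = 0 := by simpa [mderiv, mIndexList_zero, listDeriv] using hvan 0 (by simpa)
    simpa [h0] using tendsto_comp_dil hw hg.continuous x
  have hterm (s : Fin n) :
      Tendsto (fun ε : ℝ => ε ^ (w s - 1) * dirDeriv s g (dil w ε x) / ε ^ (m - 1)) (𝓝[>] 0)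
        (𝓝 (if w s ≤ m then weightedTaylor w (m - w s) (dirDeriv s g) x else 0)) := by
    have hws := hw s
    have hds := contDiff_dirDeriv hg s
    split_ifs with hs
    · refine (ih (m - w s) (by omega) hds fun β hβ => ?_).congr' ?_
      · rw [mderiv_dirDeriv hg]
        refine hvan _ ?_
        rw [weight_add_single]
        omega
      · filter_upwards [hpos] with ε hε
        rw [show m - 1 = (w s - 1) + (m - w s) by omega, pow_add]
        field_simp
    · have h := (hpow (k := w s - m) (by omega)).mul (tendsto_comp_dil hw hds.continuous x)
      rw [zero_mul] at h
      refine h.congr' ?_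
      filter_upwards [hpos] with ε hε
      rw [show w s - 1 = (m - 1) + (w s - m) by omega, pow_add]
      field_simp
  have hsum := (tendsto_finsetSum Finset.univ
    fun s _ => (hterm s).const_mul ((w s : ℝ) * x s)).div_const (m : ℝ)
  rw [euler_weightedTaylor hw hg, mul_div_cancel_left₀ _ hm0] at hsum
  refine hsum.congr' ?_
  filter_upwards [hpos] with ε hε
  rw [mul_comm (m : ℝ), ← div_div, Finset.sum_div _ _ (ε ^ (m - 1))]
  simp only [mul_div_assoc]

lemma taylorPart_eq_zero {n : ℕ} (w : Fin n → ℕ) (f : VF n) {l : ℕ} {j : Fin n}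
    (h : w j < l) (x : Fin n → ℝ) : taylorPart w f l x j = 0 := by
  refine Finset.sum_eq_zero fun β _ => if_neg fun hβ => ?_
  have : (0 : ℤ) ≤ ∑ s, (β s : ℤ) * (w s : ℤ) := Finset.sum_nonneg fun s _ => by positivity
  omega

lemma taylorPart_eq_weightedTaylor {n : ℕ} {w : Fin n → ℕ} (hw : ∀ j, 0 < w j) (f : VF n)
    {l : ℕ} {j : Fin n} (h : l ≤ w j) (x : Fin n → ℝ) :
    taylorPart w f l x j = weightedTaylor w (w j - l) (fun y => f y j) x := by
  have hiff (β : Fin n → Fin (w j + 1)) :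
      (∑ s, (β s : ℤ) * (w s : ℤ)) = (w j : ℤ) - (l : ℤ) ↔
        ∑ s, (β s : ℕ) * w s = w j - l := by
    rw [← Nat.cast_sub h]
    exact_mod_cast Iff.rfl
  simp only [taylorPart, hiff]
  rw [← Finset.sum_filter]
  refine Finset.sum_bij (fun β _ s => (β s : ℕ)) ?_ ?_ ?_ fun _ _ => rfl
  · intro β hβ
    rw [mem_weightedIndices hw]
    exact (Finset.mem_filter.1 hβ).2
  · intro β _ γ _ hβγ
    exact funext fun s => Fin.ext (congrFun hβγ s)
  · intro α hα
    rw [mem_weightedIndices hw] at hα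
    refine ⟨fun s => ⟨α s, ?_⟩, by simpa using hα, rfl⟩
    have := le_of_weight_eq hw hα s
    omega

lemma weightedTaylor_dil {n : ℕ} {w : Fin n → ℕ} (hw : ∀ j, 0 < w j) (m : ℕ)
    (g : (Fin n → ℝ) → ℝ) (ε : ℝ) (x : Fin n → ℝ) :
    weightedTaylor w m g (dil w ε x) = ε ^ m * weightedTaylor w m g x := by
  rw [weightedTaylor, weightedTaylor, Finset.mul_sum]
  refine Finset.sum_congr rfl fun α hα => ?_
  rw [mem_weightedIndices hw] at hα
  simp only [taylorTerm, dil, mul_pow, Finset.prod_mul_distrib, ← pow_mul]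
  rw [Finset.prod_pow_eq_pow_sum, ← hα]
  simp only [mul_comm (w _)]
  ring

/-- the weighted Taylor part `f̂` of weight `l` of a field `f`
of graded order at most `l` is δ-homogeneous of weight `l`, and it is the
limit of `ε^l (δ_{1/ε *} f)` as `ε → 0⁺`. -/
theorem taylor_part_homogeneous_and_limit
    {n : ℕ}
    (w : Fin n → ℕ) (hw : ∀ j, 0 < w j)
    (l : ℕ) (hl : 1 ≤ l)
    (f : VF n) (hf : ContDiff ℝ (⊤ : ℕ∞) f)
    (hord : GradedOrderLE w f (l : ℤ))
    (fh : VF n) (hfh : fh = taylorPart w f l) :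
    (∀ ε > (0:ℝ), ∀ x, dil w ε (fh x) = ε ^ l • fh (dil w ε x))
    ∧ (∀ x : Fin n → ℝ,
        Tendsto (fun ε : ℝ => ε ^ l • dil w ε⁻¹ (f (dil w ε x)))
          (𝓝[>] (0:ℝ)) (𝓝 (fh x))) := by
  subst hfh
  refine ⟨fun ε _ x => funext fun j => ?_, fun x => tendsto_pi_nhds.2 fun j => ?_⟩
  · simp only [dil, Pi.smul_apply, smul_eq_mul]
    rcases lt_or_ge (w j) l with h | h
    · simp [taylorPart_eq_zero w f h]
    · rw [taylorPart_eq_weightedTaylor hw f h, taylorPart_eq_weightedTaylor hw f h]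
      rw [weightedTaylor_dil hw, ← mul_assoc, ← pow_add, Nat.add_sub_cancel' h]
  · have hfj : ContDiff ℝ (⊤ : ℕ∞) fun y => f y j := contDiff_pi.1 hf j
    have hpos : ∀ᶠ ε : ℝ in 𝓝[>] 0, 0 < ε := self_mem_nhdsWithin
    rcases lt_or_ge (w j) l with h | h
    · rw [taylorPart_eq_zero w f h]
      have hid : Tendsto (fun ε : ℝ => ε) (𝓝[>] 0) (𝓝 0) := nhdsWithin_le_nhds
      have hlim := (hid.pow (l - w j)).mul (tendsto_comp_dil hw hfj.continuous x)
      rw [zero_pow (by omega), zero_mul] at hlim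
      refine hlim.congr' ?_
      filter_upwards [hpos] with ε hε
      change _ = ε ^ l * (ε⁻¹ ^ w j * f (dil w ε x) j)
      rw [show l = (l - w j) + w j by omega, pow_add, Nat.add_sub_cancel, inv_pow]
      field_simp
    · rw [taylorPart_eq_weightedTaylor hw f h]
      refine (tendsto_comp_dil_div_pow hw x (w j - l) hfj fun α hα => hord j α ?_).congr' ?_
      · have : ((∑ s, α s * w s : ℕ) : ℤ) < (w j : ℤ) - l := by omega
        push_cast at this
        linarith
      · filter_upwards [hpos] with ε hε
        change _ = ε ^ l * (ε⁻¹ ^ w j * f (dil w ε x) j)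
        rw [inv_pow, show ε ^ w j = ε ^ l * ε ^ (w j - l) by
          rw [← pow_add, Nat.add_sub_cancel' h]]
        field_simp
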